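/- arXiv:2105.10354 — 6 statements merged into one kernel-verified Lean document; each statement's English description precedes it below -/
import Mathlib

section
/- Let ℓ be a natural number such that 2(ℓ+1) is a triangular number, and let n be a natural number with n > 2ℓ - 1. Then the binary representation of the triangular number t_{2^n + 2^ℓ - 1} contains exactly 2(ℓ+1) ones; in particular, t_{2^n + 2^ℓ - 1} is very triangular. -/
/-- The n-th triangular number. -/
def triangular (n : ℕ) : ℕ := n * (n + 1) / 2

/-- A natural number is triangular if it is `triangular n` for some `n`. -/
def IsTriangular (m : ℕ) : Prop := ∃ n : ℕ, triangular n = m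

/-- The number of 1s in the binary representation of `m` (binary digit sum). -/
def binOnes (m : ℕ) : ℕ := (Nat.digits 2 m).sum

/-- A number is very triangular if it is triangular and its binary digit sum is triangular. -/
def IsVeryTriangular (m : ℕ) : Prop := IsTriangular m ∧ IsTriangular (binOnes m)

theorem binOnes_two_mul_add {r : ℕ} (hr : r < 2) (m : ℕ) :
    binOnes (r + 2 * m) = r + binOnes m := by
  rcases Nat.eq_zero_or_pos (r + 2 * m) with h | h
  · obtain ⟨rfl, rfl⟩ : r = 0 ∧ m = 0 := by omega
    simp [binOnes]
  · have hd : Nat.digits 2 (r + 2 * m) = r :: Nat.digits 2 m :=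
      Nat.digits_add 2 (by norm_num) r m hr (by omega)
    simp [binOnes, hd]

/-- Concatenating binary expansions adds the digit sums. -/
theorem binOnes_add_two_pow_mul (k y : ℕ) :
    ∀ x < 2 ^ k, binOnes (x + 2 ^ k * y) = binOnes x + binOnes y := by
  induction k with
  | zero =>
    intro x hx
    obtain rfl : x = 0 := by simpa using hx
    simp [binOnes]
  | succ k ih =>
    intro x hx
    have hr : x % 2 < 2 := Nat.mod_lt _ (by norm_num)
    have hx' : x / 2 < 2 ^ k := by rw [pow_succ] at hx; omega
    have hsplit : x + 2 ^ (k + 1) * y = x % 2 + 2 * (x / 2 + 2 ^ k * y) := by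
      rw [pow_succ]
      linarith [Nat.mod_add_div x 2]
    have hrec := binOnes_two_mul_add hr (x / 2)
    rw [Nat.mod_add_div] at hrec
    rw [hsplit, binOnes_two_mul_add hr, ih _ hx', hrec, add_assoc]

theorem binOnes_two_pow_mul (k y : ℕ) : binOnes (2 ^ k * y) = binOnes y := by
  simpa [binOnes] using binOnes_add_two_pow_mul k y 0 (by positivity)

theorem binOnes_one : binOnes 1 = 1 := by simp [binOnes]

theorem binOnes_two_pow (k : ℕ) : binOnes (2 ^ k) = 1 := by
  simpa [binOnes_one] using binOnes_two_pow_mul k 1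

theorem binOnes_two_pow_sub_one (k : ℕ) : binOnes (2 ^ k - 1) = k := by
  induction k with
  | zero => simp [binOnes]
  | succ k ih =>
    have hk : 0 < 2 ^ k := by positivity
    have hsplit : 2 ^ (k + 1) - 1 = (2 ^ k - 1) + 2 ^ k * 1 := by rw [pow_succ]; omega
    rw [hsplit, binOnes_add_two_pow_mul k 1 _ (by omega), ih, binOnes_one]

theorem not_isTriangular_two : ¬ IsTriangular 2 := by
  rintro ⟨m, hm⟩
  unfold triangular at hm
  have hlt : m < 3 := by
    by_contra! hge
    have : 3 * 4 ≤ m * (m + 1) := Nat.mul_le_mul hge (by omega)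
    omega
  interval_cases m <;> omega

theorem triangular_two_pow_add_two_pow_sub_one (j d : ℕ) :
    triangular (2 ^ (2 * (j + 1) + d) + 2 ^ (j + 1) - 1) =
      2 ^ j * (2 ^ (j + 1) - 1) +
        2 ^ (2 * j + 1 + d) * ((2 ^ (j + 2) - 1) + 2 ^ (j + 2) * 2 ^ (j + d)) := by
  have hA : 1 ≤ 2 ^ j := Nat.one_le_two_pow
  have h1 : 2 ^ (2 * (j + 1) + d) = 4 * (2 ^ j * 2 ^ j * 2 ^ d) := by ring
  have h2 : 2 ^ (j + 1) = 2 * 2 ^ j := by ring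
  have h3 : 2 ^ (2 * j + 1 + d) = 2 * (2 ^ j * 2 ^ j * 2 ^ d) := by ring
  have h4 : 2 ^ (j + 2) = 4 * 2 ^ j := by ring
  rw [h1, h2, h3, h4, pow_add]
  generalize 2 ^ j = A at hA ⊢
  generalize 2 ^ d = D
  obtain ⟨a, rfl⟩ := Nat.exists_eq_add_of_le' hA
  have e1 : 4 * ((a + 1) * (a + 1) * D) + 2 * (a + 1) - 1 =
      4 * ((a + 1) * (a + 1) * D) + 2 * a + 1 := by omega
  have e2 : 2 * (a + 1) - 1 = 2 * a + 1 := by omega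
  have e3 : 4 * (a + 1) - 1 = 4 * a + 3 := by omega
  rw [triangular, e1, e2, e3]
  refine Nat.div_eq_of_eq_mul_left (by norm_num) ?_
  ring

theorem binOnes_triangular_two_pow_add_two_pow_sub_one (j d : ℕ) :
    binOnes (triangular (2 ^ (2 * (j + 1) + d) + 2 ^ (j + 1) - 1)) = 2 * (j + 1 + 1) := by
  have hlow : 2 ^ j * (2 ^ (j + 1) - 1) < 2 ^ (2 * j + 1 + d) :=
    calc 2 ^ j * (2 ^ (j + 1) - 1) < 2 ^ j * 2 ^ (j + 1) :=
          Nat.mul_lt_mul_of_pos_left (Nat.sub_lt (by positivity) one_pos) (by positivity)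
      _ = 2 ^ (2 * j + 1) := by ring
      _ ≤ 2 ^ (2 * j + 1 + d) := Nat.pow_le_pow_right (by norm_num) (by omega)
  have hmid : 2 ^ (j + 2) - 1 < 2 ^ (j + 2) := Nat.sub_lt (by positivity) one_pos
  rw [triangular_two_pow_add_two_pow_sub_one, binOnes_add_two_pow_mul _ _ _ hlow,
    binOnes_two_pow_mul, binOnes_add_two_pow_mul _ _ _ hmid, binOnes_two_pow_sub_one,
    binOnes_two_pow_sub_one, binOnes_two_pow]
  ring

theorem stmt0 (ℓ n : ℕ) (h : IsTriangular (2 * (ℓ + 1)))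
    (hn : (n : ℤ) > 2 * (ℓ : ℤ) - 1) :
    binOnes (triangular (2 ^ n + 2 ^ ℓ - 1)) = 2 * (ℓ + 1) ∧
      IsVeryTriangular (triangular (2 ^ n + 2 ^ ℓ - 1)) := by
  have hones : binOnes (triangular (2 ^ n + 2 ^ ℓ - 1)) = 2 * (ℓ + 1) := by
    cases ℓ with
    | zero => exact absurd h not_isTriangular_two
    | succ j =>
      obtain ⟨d, rfl⟩ : ∃ d, n = 2 * (j + 1) + d := Nat.exists_eq_add_of_le (by omega)
      exact binOnes_triangular_two_pow_add_two_pow_sub_one j d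
  exact ⟨hones, ⟨_, rfl⟩, hones ▸ h⟩
end

section
/- Let ℓ > 1 be a natural number such that 2ℓ + 1 is a triangular number. Then the binary representation of the triangular number t_{2^{2ℓ} - 2^ℓ + 1} contains exactly 2ℓ + 1 ones; in particular, t_{2^{2ℓ} - 2^ℓ + 1} is very triangular. -/
theorem binOnes_two_mul (a : ℕ) : binOnes (2 * a) = binOnes a := by
  rcases Nat.eq_zero_or_pos a with rfl | ha
  · simp
  · have := Nat.digits_add_two_add_one 0 (2 * a - 1)
    rw [Nat.sub_add_cancel (by lia)] at this
    simp [binOnes, this]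

theorem binOnes_two_mul_add_one (a : ℕ) : binOnes (2 * a + 1) = binOnes a + 1 := by
  have h : (2 * a + 1) / 2 = a := by lia
  simp [binOnes, h, add_comm 1 (List.sum _)]

/-- Binary digit sums add when the bits of `b` lie below the shifted bits of `a`. -/
theorem binOnes_two_pow_mul_add (k a b : ℕ) (hb : b < 2 ^ k) :
    binOnes (2 ^ k * a + b) = binOnes a + binOnes b := by
  induction k generalizing b with
  | zero =>
    obtain rfl : b = 0 := by simpa using hb
    simp [binOnes]
  | succ k ih =>
    rw [pow_succ] at hb
    obtain ⟨c, rfl | rfl⟩ := b.even_or_odd'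
    · rw [show 2 ^ (k + 1) * a + 2 * c = 2 * (2 ^ k * a + c) by ring, binOnes_two_mul,
        binOnes_two_mul, ih c (by lia)]
    · rw [show 2 ^ (k + 1) * a + (2 * c + 1) = 2 * (2 ^ k * a + c) + 1 by ring,
        binOnes_two_mul_add_one, binOnes_two_mul_add_one, ih c (by lia), add_assoc]

theorem binOnes_of_add_one_eq_two_pow {m q : ℕ} (h : q + 1 = 2 ^ m) : binOnes q = m := by
  induction m generalizing q with
  | zero =>
    obtain rfl : q = 0 := by simpa using h
    simp [binOnes]
  | succ m ih =>
    rw [pow_succ] at h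
    have hm : 0 < 2 ^ m := by positivity
    obtain ⟨c, rfl⟩ : ∃ c, q = 2 * c + 1 := ⟨2 ^ m - 1, by lia⟩
    rw [binOnes_two_mul_add_one, ih (by lia)]

theorem triangular_eq_of_add_one_eq_two_pow {m q : ℕ} (h : q + 1 = 2 ^ m) :
    triangular (2 ^ (2 * (m + 1)) - 2 ^ (m + 1) + 1) =
      2 ^ m * (2 ^ (2 * m + 2) * (2 * q) + (2 * (2 * (2 * q + 1)) + 1)) + 1 := by
  have h₁ : 2 ^ (m + 1) = 2 * (q + 1) := by rw [h]; ring
  have h₂ : 2 ^ (2 * m + 2) = 4 * (q + 1) ^ 2 := by rw [h]; ring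
  have h₃ : 2 ^ (2 * (m + 1)) - 2 ^ (m + 1) = 2 * (q + 1) * (2 * q + 1) := by
    rw [h₁, show 2 * (m + 1) = 2 * m + 2 by ring, h₂]
    exact Nat.sub_eq_of_eq_add (by ring)
  rw [triangular, h₃, h₂, ← h]
  exact Nat.div_eq_of_eq_mul_left two_pos (by ring)

theorem stmt4 (ℓ : ℕ) (hℓ : ℓ > 1) (h : IsTriangular (2 * ℓ + 1)) :
    binOnes (triangular (2 ^ (2 * ℓ) - 2 ^ ℓ + 1)) = 2 * ℓ + 1 ∧
      IsVeryTriangular (triangular (2 ^ (2 * ℓ) - 2 ^ ℓ + 1)) := by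
  have key : binOnes (triangular (2 ^ (2 * ℓ) - 2 ^ ℓ + 1)) = 2 * ℓ + 1 := by
    obtain ⟨m, rfl⟩ : ∃ m, ℓ = m + 1 := ⟨ℓ - 1, by lia⟩
    obtain ⟨q, hq⟩ : ∃ q, q + 1 = 2 ^ m := ⟨2 ^ m - 1, Nat.sub_add_cancel Nat.one_le_two_pow⟩
    have hm : 1 < 2 ^ m := Nat.one_lt_two_pow (by lia)
    have hlow : 2 * (2 * (2 * q + 1)) + 1 < 2 ^ (2 * m + 2) := by
      have : 2 ^ (2 * m + 2) = 4 * (q + 1) ^ 2 := by rw [hq]; ring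
      nlinarith
    have hone : binOnes 1 = 1 := by simp [binOnes]
    rw [triangular_eq_of_add_one_eq_two_pow hq, binOnes_two_pow_mul_add _ _ _ hm,
      binOnes_two_pow_mul_add _ _ _ hlow, binOnes_two_mul, binOnes_two_mul_add_one,
      binOnes_two_mul, binOnes_two_mul_add_one, binOnes_of_add_one_eq_two_pow hq, hone]
    ring
  exact ⟨key, ⟨_, rfl⟩, key ▸ h⟩
end

section
/- Let n be a natural number whose binary representation contains at most five 1s. If the binary representation of the triangular number t_n = n(n+1)/2 contains exactly three 1s, then t_n ∈ {21, 28, 276, 1540}. -/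
theorem binOnes_zero : binOnes 0 = 0 := by simp [binOnes]

theorem binOnes_two_mul_add_s5 (n b : ℕ) (hb : b < 2) :
    binOnes (2 * n + b) = binOnes n + b := by
  rcases Nat.eq_zero_or_pos (2 * n + b) with h | h
  · obtain ⟨rfl, rfl⟩ : n = 0 ∧ b = 0 := by omega
    simp [binOnes]
  · unfold binOnes
    rw [Nat.digits_def' (by norm_num) h, List.sum_cons, show (2 * n + b) % 2 = b by omega,
      show (2 * n + b) / 2 = n by omega, add_comm]

theorem binOnes_add_pow_mul (p m r : ℕ) (hm : m < 2 ^ p) :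
    binOnes (m + 2 ^ p * r) = binOnes m + binOnes r := by
  induction p generalizing m with
  | zero =>
    obtain rfl : m = 0 := by simpa using hm
    simp [binOnes_zero]
  | succ p ih =>
    have h1 : m + 2 ^ (p + 1) * r = 2 * (m / 2 + 2 ^ p * r) + m % 2 := by
      rw [pow_succ, mul_add, ← mul_assoc, mul_comm (2 ^ p) 2]; omega
    have h2 := binOnes_two_mul_add_s5 (m / 2) (m % 2) (by omega)
    rw [Nat.div_add_mod] at h2
    rw [h1, binOnes_two_mul_add_s5 _ _ (by omega), ih _ (by rw [pow_succ] at hm; omega), h2]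
    ring

theorem binOnes_pow_mul (p r : ℕ) : binOnes (2 ^ p * r) = binOnes r := by
  simpa [binOnes_zero] using binOnes_add_pow_mul p 0 r (by positivity)

theorem binOnes_one_add_pow_mul {p : ℕ} (hp : 1 ≤ p) (r : ℕ) :
    binOnes (1 + 2 ^ p * r) = 1 + binOnes r := by
  rw [binOnes_add_pow_mul p 1 r (Nat.one_lt_two_pow (by omega))]
  simp [binOnes]

theorem binOnes_mod_le (p n : ℕ) : binOnes (n % 2 ^ p) ≤ binOnes n := by
  have h := binOnes_add_pow_mul p (n % 2 ^ p) (n / 2 ^ p) (Nat.mod_lt _ (by positivity))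
  rw [Nat.mod_add_div] at h
  omega

theorem exists_eq_one_add_pow_mul {u : ℕ} (hu : Odd u) (h1 : u ≠ 1) :
    ∃ j r, 1 ≤ j ∧ Odd r ∧ u = 1 + 2 ^ j * r ∧ binOnes u = 1 + binOnes r := by
  obtain ⟨v, rfl⟩ := hu
  obtain ⟨j, r, hr, h⟩ := Nat.exists_eq_two_pow_mul_odd (n := v) (by omega)
  have e : 2 * v + 1 = 1 + 2 ^ (j + 1) * r := by rw [h]; ring
  exact ⟨j + 1, r, by omega, hr, e, by rw [e, binOnes_one_add_pow_mul (by omega)]⟩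

theorem binOnes_pos {n : ℕ} (hn : n ≠ 0) : 1 ≤ binOnes n := by
  obtain ⟨a, u, ⟨v, rfl⟩, rfl⟩ := Nat.exists_eq_two_pow_mul_odd hn
  rw [binOnes_pow_mul, binOnes_two_mul_add_s5 _ _ (by omega)]
  omega

theorem eq_one_of_odd_of_binOnes_le_one {u : ℕ} (hu : Odd u) (h : binOnes u ≤ 1) : u = 1 := by
  by_contra h1
  obtain ⟨j, r, -, hr, -, hb⟩ := exists_eq_one_add_pow_mul hu h1
  have := binOnes_pos hr.pos.ne'
  omega

theorem eq_one_add_pow_of_binOnes_eq_two {u : ℕ} (hu : Odd u) (h : binOnes u = 2) :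
    ∃ e, 1 ≤ e ∧ u = 1 + 2 ^ e := by
  obtain ⟨j, r, hj, hr, e, hb⟩ :=
    exists_eq_one_add_pow_mul hu (by rintro rfl; simp [binOnes] at h)
  obtain rfl := eq_one_of_odd_of_binOnes_le_one hr (by omega)
  exact ⟨j, hj, by simpa using e⟩

theorem eq_one_of_odd_of_mul_eq_pow {x y e : ℕ} (hx : Odd x) (h : x * y = 2 ^ e) : x = 1 := by
  obtain ⟨k, -, rfl⟩ := (Nat.dvd_prime_pow Nat.prime_two).1 (Dvd.intro y h)
  rcases Nat.eq_zero_or_pos k with rfl | hk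
  · rfl
  · exact absurd hx (by simp [Nat.even_pow, hk.ne'])

theorem two_le_binOnes_mul {x : ℕ} (y : ℕ) (hx : Odd x) (h1 : x ≠ 1) (hy : y ≠ 0) :
    2 ≤ binOnes (x * y) := by
  by_contra! h
  obtain ⟨a, u, hu, e⟩ := Nat.exists_eq_two_pow_mul_odd (mul_ne_zero hx.pos.ne' hy)
  rw [e, binOnes_pow_mul] at h
  obtain rfl := eq_one_of_odd_of_binOnes_le_one hu (by omega)
  exact h1 (eq_one_of_odd_of_mul_eq_pow hx (by simpa using e))

theorem pow_mul_odd_inj {x y A B : ℕ} (hA : Odd A) (hB : Odd B)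
    (h : 2 ^ x * A = 2 ^ y * B) : x = y ∧ A = B := by
  have key : ∀ {x y A B : ℕ}, Odd B → 2 ^ x * A = 2 ^ y * B → x ≤ y := by
    intro x y A B hB h
    have h2 : Nat.Coprime (2 ^ x) B := Nat.Coprime.pow_left _ (Nat.coprime_two_left.2 hB)
    exact (Nat.pow_dvd_pow_iff_le_right (by norm_num)).1 (h2.dvd_of_dvd_mul_right (Dvd.intro A h))
  obtain rfl := le_antisymm (key hB h) (key hA h.symm)
  exact ⟨rfl, Nat.eq_of_mul_eq_mul_left (by positivity) h⟩

/-- If `n` agrees with `m ≥ 2` up to a zero gap reaching past the top of `m * (m + 1)`, then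
`n * (n + 1)` has at least four binary ones. -/
theorem four_le_binOnes_of_gap {m p r : ℕ} (hm : 2 ≤ m) (hp : m * (m + 1) < 2 ^ p)
    (hr : r ≠ 0) : 4 ≤ binOnes ((m + 2 ^ p * r) * (m + 2 ^ p * r + 1)) := by
  have e : (m + 2 ^ p * r) * (m + 2 ^ p * r + 1)
      = m * (m + 1) + 2 ^ p * ((2 * m + 1 + 2 ^ p * r) * r) := by ring
  have hp0 : p ≠ 0 := by
    rintro rfl
    have : 2 * 3 ≤ m * (m + 1) := by gcongr; omega
    omega
  have h1 : 2 ≤ binOnes (m * (m + 1)) := by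
    rcases Nat.even_or_odd m with h | h
    · rw [mul_comm]
      exact two_le_binOnes_mul _ h.add_one (by omega) (by omega)
    · exact two_le_binOnes_mul _ h (by omega) (by omega)
  have h2 : 2 ≤ binOnes ((2 * m + 1 + 2 ^ p * r) * r) := by
    refine two_le_binOnes_mul _ (Odd.add_even ⟨m, rfl⟩ ?_) (by omega) hr
    exact Even.mul_right (by simp [Nat.even_pow, hp0]) _
  rw [e, binOnes_add_pow_mul _ _ _ hp]
  omega

theorem binOnes_ne_three_of_one_mod {p r : ℕ} (hp : 8 ≤ p) (hr : r ≠ 0)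
    (h5 : binOnes (1 + 2 ^ p * r) ≤ 5) :
    binOnes ((1 + 2 ^ p * r) * (1 + 2 ^ p * r + 1)) ≠ 3 := by
  intro h3
  obtain ⟨i, s, hs, rfl⟩ := Nat.exists_eq_two_pow_mul_odd hr
  rw [← mul_assoc, ← pow_add] at h3 h5
  obtain ⟨d, hd⟩ : ∃ d, p + i = 8 + d := ⟨p + i - 8, by omega⟩
  rw [hd] at h3 h5
  have hlt : 2 < 2 ^ (8 + d) := by
    have := Nat.one_le_two_pow (n := d)
    rw [pow_add]; omega
  have e : (1 + 2 ^ (8 + d) * s) * (1 + 2 ^ (8 + d) * s + 1)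
      = 2 + 2 ^ (8 + d) * (3 * s + 2 ^ (8 + d) * s ^ 2) := by ring
  rw [e, binOnes_add_pow_mul _ _ _ hlt, show binOnes 2 = 1 by simp [binOnes]] at h3
  rw [binOnes_one_add_pow_mul (by omega)] at h5
  have hodd : Odd (3 * s + 2 ^ (8 + d) * s ^ 2) :=
    (Odd.mul (by decide) hs).add_even (Even.mul_right (by simp [Nat.even_pow]) _)
  obtain ⟨f, hf, ef⟩ := eq_one_add_pow_of_binOnes_eq_two hodd (by omega)
  have hs1 := hs.pos
  have hle : 2 ^ (8 + d) ≤ 2 ^ f := by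
    have : 2 ^ (8 + d) * 1 ≤ 2 ^ (8 + d) * s ^ 2 := by gcongr; exact Nat.one_le_pow _ _ hs1
    omega
  have hf8 : 8 + d ≤ f := (Nat.pow_le_pow_iff_right (by norm_num)).1 hle
  obtain ⟨g, rfl⟩ : ∃ g, f = 8 + g := ⟨f - 8, by omega⟩
  rw [pow_add, pow_add, mul_assoc] at ef
  have hmod : s % 2 ^ 8 = 171 := by
    norm_num at ef ⊢
    omega
  have := binOnes_mod_le 8 s
  rw [hmod, show binOnes 171 = 5 by simp [binOnes]] at this
  omega

theorem not_pow_mul_add_pow_mul_eq_pow {a j u r e : ℕ} (ha : 5 ≤ a) (hj : 1 ≤ j) (hja : j < a)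
    (hr : Odd r) (hu : u = 1 + 2 ^ j * r) (h4 : binOnes r ≤ 4) :
    r + 2 ^ (a - j) * u ^ 2 ≠ 1 + 2 ^ e := by
  intro h
  have hr1 := hr.pos
  have huo : Odd u := by
    rw [hu]; exact odd_one.add_even (Even.mul_right (by simp [Nat.even_pow]; omega) _)
  have hu1 : u ≠ 1 := by
    have : 0 < 2 ^ j * r := by positivity
    omega
  obtain ⟨d, rfl⟩ : ∃ d, a = j + (d + 1) := ⟨a - j - 1, by omega⟩
  rw [Nat.add_sub_cancel_left] at h
  by_cases hr' : r = 1
  · have h' : u * (2 ^ (d + 1) * u) = 2 ^ e := by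
      rw [hr'] at h; linarith
    exact hu1 (eq_one_of_odd_of_mul_eq_pow huo h')
  obtain ⟨k, s, hk, hs, rs, hb⟩ := exists_eq_one_add_pow_mul hr hr'
  have hs1 := hs.pos
  have h' : 2 ^ k * s + 2 ^ (d + 1) * u ^ 2 = 2 ^ e := by rw [rs] at h; linarith
  have hu2 : 0 < u ^ 2 := by have := huo.pos; positivity
  rcases lt_trichotomy k (d + 1) with hlt | rfl | hlt
  · obtain ⟨c, hc⟩ : ∃ c, d + 1 = k + (c + 1) := ⟨d - k, by omega⟩
    have ev : Even (2 ^ (c + 1) * u ^ 2) := Even.mul_right (by simp [Nat.even_pow]) _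
    have := eq_one_of_odd_of_mul_eq_pow (x := s + 2 ^ (c + 1) * u ^ 2) (y := 2 ^ k) (e := e)
      (hs.add_even ev) (by rw [← h', hc]; ring)
    have : 0 < 2 ^ (c + 1) * u ^ 2 := by positivity
    omega
  · have h2 : 2 ^ (d + 1) * (s + u ^ 2) = 2 ^ e := by linarith
    obtain ⟨f, -, hf⟩ := (Nat.dvd_prime_pow Nat.prime_two).1 (Dvd.intro_left _ h2)
    have eu : u = 1 + 2 ^ j + 2 ^ (j + (d + 1)) * s := by rw [hu, rs]; ring
    obtain ⟨c, hc⟩ : ∃ c, j + (d + 1) = 5 + c := ⟨j + d + 1 - 5, by omega⟩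
    rw [hc, pow_add, mul_assoc] at eu
    have hz : 1 ≤ 2 ^ c * s := Nat.mul_pos (by positivity) hs1
    generalize 2 ^ c * s = z at eu hz
    have hf6 : 6 ≤ f := by
      by_contra! hf5
      have h1 : 2 ^ f ≤ 2 ^ 5 := Nat.pow_le_pow_right (by norm_num) (by omega)
      have h2 : 32 ≤ u := by linarith [Nat.zero_le (2 ^ j)]
      nlinarith
    obtain ⟨g, rfl⟩ : ∃ g, f = 6 + g := ⟨f - 6, by omega⟩
    have hsq : u ^ 2 = (1 + 2 ^ j) ^ 2 + 64 * ((1 + 2 ^ j) * z + 16 * z ^ 2) := by rw [eu]; ring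
    rw [hsq, pow_add] at hf
    generalize (1 + 2 ^ j) * z + 16 * z ^ 2 = y at hf
    generalize 2 ^ g = G at hf
    have hm := binOnes_mod_le 6 s
    have hs3 : binOnes s ≤ 3 := by omega
    rcases Nat.lt_or_ge j 6 with hj6 | hj6
    · interval_cases j
      · have : s % 2 ^ 6 = 55 := by norm_num at hf ⊢; omega
        rw [this, show binOnes 55 = 5 by simp [binOnes]] at hm; omega
      · have : s % 2 ^ 6 = 39 := by norm_num at hf ⊢; omega
        rw [this, show binOnes 39 = 4 by simp [binOnes]] at hm; omega
      · have : s % 2 ^ 6 = 47 := by norm_num at hf ⊢; omega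
        rw [this, show binOnes 47 = 5 by simp [binOnes]] at hm; omega
      · have : s % 2 ^ 6 = 31 := by norm_num at hf ⊢; omega
        rw [this, show binOnes 31 = 5 by simp [binOnes]] at hm; omega
      · have : s % 2 ^ 6 = 63 := by norm_num at hf ⊢; omega
        rw [this, show binOnes 63 = 6 by simp [binOnes]] at hm; omega
    · obtain ⟨i, rfl⟩ : ∃ i, j = 6 + i := ⟨j - 6, by omega⟩
      have hsq' : (1 + 2 ^ (6 + i)) ^ 2 = 1 + 64 * (2 * 2 ^ i + 64 * (2 ^ i) ^ 2) := by ring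
      rw [hsq'] at hf
      have : s % 2 ^ 6 = 63 := by
        generalize 2 * 2 ^ i + 64 * (2 ^ i) ^ 2 = w at hf
        norm_num at hf ⊢; omega
      rw [this, show binOnes 63 = 6 by simp [binOnes]] at hm; omega
  · obtain ⟨c, rfl⟩ : ∃ c, k = (d + 1) + (c + 1) := ⟨k - d - 2, by omega⟩
    have ev : Even (2 ^ (c + 1) * s) := Even.mul_right (by simp [Nat.even_pow]) _
    have := eq_one_of_odd_of_mul_eq_pow (x := u ^ 2 + 2 ^ (c + 1) * s) (y := 2 ^ (d + 1)) (e := e)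
      (huo.pow.add_even ev) (by rw [← h']; ring)
    have : 0 < 2 ^ (c + 1) * s := by positivity
    omega

theorem not_add_sq_eq_pow_add_pow {a r p q : ℕ} (ha : 5 ≤ a) (hr : Odd r) (hpq : p < q)
    (h4 : binOnes r ≤ 4) : r + (1 + 2 ^ a * r) ^ 2 ≠ 2 ^ p + 2 ^ q := by
  intro h
  have hr1 := hr.pos
  have hexp : (1 + 2 ^ a * r) ^ 2 = 1 + 2 ^ (a + 1) * r + 2 ^ (2 * a) * r ^ 2 := by ring
  rw [hexp] at h
  have hq : 2 * a ≤ q := by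
    have h1 : 2 ^ (2 * a) * 1 ≤ 2 ^ (2 * a) * r ^ 2 := by gcongr; exact Nat.one_le_pow _ _ hr1
    have h2 : 2 ^ p < 2 ^ q := Nat.pow_lt_pow_right (by norm_num) hpq
    have h3 : 2 ^ (2 * a) < 2 ^ (q + 1) := by
      rw [pow_succ 2 q]
      omega
    have := (Nat.pow_lt_pow_iff_right (by norm_num)).1 h3
    omega
  obtain ⟨c, rfl⟩ : ∃ c, a = 5 + c := ⟨a - 5, by omega⟩
  obtain ⟨d, rfl⟩ : ∃ d, q = 2 * (5 + c) + d := ⟨q - 2 * (5 + c), by omega⟩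
  have hL : r + 1 + 2 ^ (5 + c + 1) * (r + 2 ^ (4 + c) * r ^ 2)
      = 2 ^ p + 2 ^ (5 + c + 1) * 2 ^ (4 + c + d) := by
    have e1 : 2 ^ (2 * (5 + c)) = 2 ^ (5 + c + 1) * 2 ^ (4 + c) := by ring
    have e2 : 2 ^ (2 * (5 + c) + d) = 2 ^ (5 + c + 1) * 2 ^ (4 + c + d) := by ring
    rw [e1, e2] at h
    linarith
  have h64 : r + 1 + 64 * (2 ^ c * (r + 2 ^ (4 + c) * r ^ 2))
      = 2 ^ p + 64 * (2 ^ c * 2 ^ (4 + c + d)) := by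
    have e3 : 2 ^ (5 + c + 1) = 64 * 2 ^ c := by ring
    rw [e3] at hL
    linarith
  have hm := binOnes_mod_le 6 r
  have hp : p ≤ 4 := by
    by_contra! hp
    generalize 2 ^ c * (r + 2 ^ (4 + c) * r ^ 2) = X at h64
    generalize 2 ^ c * 2 ^ (4 + c + d) = Y at h64
    rcases Nat.lt_or_ge p 6 with hp6 | hp6
    · obtain rfl : p = 5 := by omega
      have : r % 2 ^ 6 = 31 := by norm_num at h64 ⊢; omega
      rw [this, show binOnes 31 = 5 by simp [binOnes]] at hm; omega
    · obtain ⟨i, rfl⟩ : ∃ i, p = 6 + i := ⟨p - 6, by omega⟩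
      rw [pow_add] at h64
      have : r % 2 ^ 6 = 63 := by norm_num at h64 ⊢; omega
      rw [this, show binOnes 63 = 6 by simp [binOnes]] at hm; omega
  have hle : 2 ^ p ≤ r + 1 := by
    generalize 2 ^ c * (r + 2 ^ (4 + c) * r ^ 2) = X at h64
    generalize 2 ^ c * 2 ^ (4 + c + d) = Y at h64
    have : 2 ^ p ≤ 2 ^ 4 := Nat.pow_le_pow_right (by norm_num) hp
    omega
  obtain ⟨v, hv⟩ := Nat.exists_eq_add_of_le hle
  have hdvd : 2 ^ (5 + c + 1) ∣ v := by
    have h1 : v + 2 ^ (5 + c + 1) * (r + 2 ^ (4 + c) * r ^ 2)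
        = 2 ^ (5 + c + 1) * 2 ^ (4 + c + d) := by omega
    exact (Nat.dvd_add_left (Dvd.intro _ rfl)).1 (h1 ▸ Dvd.intro _ rfl)
  obtain ⟨w, rfl⟩ := hdvd
  have hw : w + r + 2 ^ (4 + c) * r ^ 2 = 2 ^ (4 + c + d) := by
    refine Nat.eq_of_mul_eq_mul_left (show 0 < 2 ^ (5 + c + 1) by positivity) ?_
    rw [hv] at hL
    linarith
  have hw16 : w + r + 16 * (2 ^ c * r ^ 2) = 16 * 2 ^ (c + d) := by
    have e1 : 2 ^ (4 + c) = 16 * 2 ^ c := by ring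
    have e2 : 2 ^ (4 + c + d) = 16 * 2 ^ (c + d) := by ring
    rw [e1, e2] at hw
    linarith
  have hp1 : 1 ≤ 2 ^ p := Nat.one_le_two_pow
  have hrw : r = (2 ^ p - 1) + 2 ^ (5 + c + 1) * w := by omega
  have hb : binOnes r = binOnes (2 ^ p - 1) + binOnes w := by
    conv_lhs => rw [hrw]
    refine binOnes_add_pow_mul _ _ _ ?_
    have : 2 ^ p ≤ 2 ^ (5 + c + 1) := Nat.pow_le_pow_right (by norm_num) (by omega)
    omega
  have e3 : 2 ^ (5 + c + 1) * w = 64 * (2 ^ c * w) := by ring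
  rw [e3] at hrw
  have hmw := binOnes_mod_le 4 w
  generalize 2 ^ c * w = z at hrw
  generalize 2 ^ c * r ^ 2 = x at hw16
  generalize 2 ^ (c + d) = y at hw16
  obtain ⟨t, rfl⟩ := hr
  interval_cases p
  · omega
  · have : w % 2 ^ 4 = 15 := by norm_num at hrw ⊢; omega
    rw [this, show binOnes 15 = 4 by simp [binOnes]] at hmw
    rw [show binOnes (2 ^ 1 - 1) = 1 by simp [binOnes]] at hb; omega
  · have : w % 2 ^ 4 = 13 := by norm_num at hrw ⊢; omega
    rw [this, show binOnes 13 = 3 by simp [binOnes]] at hmw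
    rw [show binOnes (2 ^ 2 - 1) = 2 by simp [binOnes]] at hb; omega
  · have : w % 2 ^ 4 = 9 := by norm_num at hrw ⊢; omega
    rw [this, show binOnes 9 = 2 by simp [binOnes]] at hmw
    rw [show binOnes (2 ^ 3 - 1) = 3 by simp [binOnes]] at hb; omega
  · have : w % 2 ^ 4 = 1 := by norm_num at hrw ⊢; omega
    rw [this, show binOnes 1 = 1 by simp [binOnes]] at hmw
    rw [show binOnes (2 ^ 4 - 1) = 4 by simp [binOnes]] at hb; omega

theorem binOnes_ne_three_of_pow_dvd {a u : ℕ} (ha : 5 ≤ a) (hu : Odd u) (h5 : binOnes u ≤ 5) :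
    binOnes (2 ^ a * u * (2 ^ a * u + 1)) ≠ 3 := by
  intro h3
  have h3' := h3
  have e : 2 ^ a * u * (2 ^ a * u + 1) = 2 ^ a * (u + 2 ^ a * u ^ 2) := by ring
  rw [e, binOnes_pow_mul] at h3
  have ev2 : ∀ k, 1 ≤ k → Even (2 ^ k) := fun k hk => by simp [Nat.even_pow]; omega
  by_cases hu1 : u = 1
  · rw [hu1, one_pow, binOnes_one_add_pow_mul (by omega),
      show binOnes 1 = 1 by simp [binOnes]] at h3
    omega
  obtain ⟨j, r, hj, hr, ur, hb⟩ := exists_eq_one_add_pow_mul hu hu1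
  have hr1 := hr.pos
  have hupos := hu.pos
  have hodd : Odd (u + 2 ^ a * u ^ 2) := hu.add_even ((ev2 a (by omega)).mul_right _)
  obtain ⟨b, M, hb1, hM, eM, hbM⟩ :=
    exists_eq_one_add_pow_mul hodd (by have : 0 < 2 ^ a * u ^ 2 := by positivity
                                       omega)
  obtain ⟨c, hc, rfl⟩ := eq_one_add_pow_of_binOnes_eq_two hM (by omega)
  have hE : 2 ^ j * r + 2 ^ a * u ^ 2 = 2 ^ b * (1 + 2 ^ c) := by omega
  rcases lt_trichotomy j a with hja | rfl | hja
  · have hA : Odd (r + 2 ^ (a - j) * u ^ 2) := hr.add_even ((ev2 _ (by omega)).mul_right _)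
    have h1 : 2 ^ j * (r + 2 ^ (a - j) * u ^ 2) = 2 ^ b * (1 + 2 ^ c) := by
      rw [← hE, mul_add, ← mul_assoc, ← pow_add, Nat.add_sub_cancel' hja.le]
    exact not_pow_mul_add_pow_mul_eq_pow ha hj hja hr ur (by omega) (pow_mul_odd_inj hA hM h1).2
  · have h1 : 2 ^ j * (r + u ^ 2) = 2 ^ b * (1 + 2 ^ c) := by rw [← hE]; ring
    have hjb : j ≤ b := by
      have h2 : Nat.Coprime (2 ^ j) (1 + 2 ^ c) :=
        Nat.Coprime.pow_left _ (Nat.coprime_two_left.2 hM)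
      exact (Nat.pow_dvd_pow_iff_le_right (by norm_num)).1
        (h2.dvd_of_dvd_mul_right (Dvd.intro _ h1))
    obtain ⟨p, rfl⟩ := Nat.exists_eq_add_of_le hjb
    have h2 : r + u ^ 2 = 2 ^ p + 2 ^ (p + c) := by
      refine Nat.eq_of_mul_eq_mul_left (show 0 < 2 ^ j by positivity) ?_
      rw [h1]; ring
    rw [ur] at h2
    exact not_add_sq_eq_pow_add_pow ha hr (by omega) (by omega) h2
  · have h1 : 2 ^ a * u = 2 ^ a + 2 ^ (a + j) * r := by rw [ur]; ring
    have h2 : 2 ^ 1 ≤ 2 ^ a := Nat.pow_le_pow_right (by norm_num) (by omega)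
    have h3 : 2 ^ (a + 1) ≤ 2 ^ j := Nat.pow_le_pow_right (by norm_num) (by omega)
    rw [pow_succ] at h3
    have h4 := four_le_binOnes_of_gap (m := 2 ^ a) (p := a + j) (r := r) (by omega)
      (by rw [pow_add]; gcongr; omega) hr1.ne'
    rw [← h1] at h4
    omega

/-- Conditions under which a number `m + 2 ^ p * r` with at most five binary ones whose product
with its successor has exactly three binary ones must have `r = 0`. -/
def IsTerminal (m p : ℕ) : Prop :=
  (2 ≤ m ∧ m * (m + 1) < 2 ^ p) ∨ (m = 1 ∧ 8 ≤ p) ∨ (m = 0 ∧ 5 ≤ p)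

instance (m p : ℕ) : Decidable (IsTerminal m p) := by unfold IsTerminal; infer_instance

theorem IsTerminal.eq_zero {m p r : ℕ} (h : IsTerminal m p) (h5 : binOnes (m + 2 ^ p * r) ≤ 5)
    (h3 : binOnes ((m + 2 ^ p * r) * (m + 2 ^ p * r + 1)) = 3) : r = 0 := by
  by_contra hr
  rcases h with ⟨hm, hp⟩ | ⟨rfl, hp⟩ | ⟨rfl, hp⟩
  · have := four_le_binOnes_of_gap hm hp hr
    omega
  · exact binOnes_ne_three_of_one_mod hp hr h5 h3
  · obtain ⟨i, u, hu, rfl⟩ := Nat.exists_eq_two_pow_mul_odd hr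
    rw [zero_add, ← mul_assoc, ← pow_add] at h3 h5
    rw [binOnes_pow_mul] at h5
    exact binOnes_ne_three_of_pow_dvd (by omega) hu h5 h3

/-- The number of ones among the `fuel` lowest binary digits of `n`. -/
def lowOnes : ℕ → ℕ → ℕ
  | 0, _ => 0
  | fuel + 1, n => n % 2 + lowOnes fuel (n / 2)

theorem lowOnes_eq (k n : ℕ) : lowOnes k n = binOnes (n % 2 ^ k) := by
  induction k generalizing n with
  | zero => simp [lowOnes, Nat.mod_one, binOnes_zero]
  | succ k ih =>
    have h : n % 2 ^ (k + 1) = 2 * (n / 2 % 2 ^ k) + n % 2 := by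
      rw [pow_succ', Nat.mod_mul]; omega
    rw [lowOnes, ih, h, binOnes_two_mul_add_s5 _ _ (by omega), add_comm]

/-- Search through the numbers whose `p` lowest binary digits form `m` and which have at most `k`
further ones, confirming that only `6`, `7`, `23` and `55` can have a product with their successor
with exactly three ones. -/
def search : ℕ → ℕ → ℕ → ℕ → Bool
  | 0, _, _, _ => false
  | fuel + 1, k, p, m =>
    (decide (m ∈ [6, 7, 23, 55]) || decide (lowOnes (2 * p) (m * (m + 1)) ≠ 3)) &&
    (decide (IsTerminal m p) || decide (3 < lowOnes p (m * (m + 1))) ||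
      (search fuel k (p + 1) m &&
        (decide (k = 0) || search fuel (k - 1) (p + 1) (m + 2 ^ p))))

theorem mem_of_search {fuel k p m r : ℕ} (hs : search fuel k p m = true) (hm : m < 2 ^ p)
    (hr : binOnes r ≤ k) (h5 : binOnes (m + 2 ^ p * r) ≤ 5)
    (h3 : binOnes ((m + 2 ^ p * r) * (m + 2 ^ p * r + 1)) = 3) :
    m + 2 ^ p * r ∈ [6, 7, 23, 55] := by
  induction fuel generalizing k p m r with
  | zero => simp [search] at hs
  | succ fuel ih =>
    simp only [search, Bool.and_eq_true, Bool.or_eq_true, decide_eq_true_eq] at hs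
    obtain ⟨hself, hnext⟩ := hs
    by_cases hr0 : r = 0
    · subst hr0
      rw [mul_zero, add_zero] at h3 ⊢
      refine hself.resolve_right fun h => h ?_
      have hlt : m * (m + 1) < 2 ^ (2 * p) := by
        rw [two_mul, pow_add]
        exact Nat.mul_lt_mul_of_lt_of_le hm hm (by positivity)
      rwa [lowOnes_eq, Nat.mod_eq_of_lt hlt]
    have hlow : ¬ 3 < lowOnes p (m * (m + 1)) := by
      have h := binOnes_mod_le p ((m + 2 ^ p * r) * (m + 2 ^ p * r + 1))
      have e : (m + 2 ^ p * r) * (m + 2 ^ p * r + 1)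
          = m * (m + 1) + 2 ^ p * (r * (2 * m + 1 + 2 ^ p * r)) := by ring
      rw [h3, e, Nat.add_mul_mod_self_left, ← lowOnes_eq] at h
      omega
    obtain ⟨hzero, hone⟩ := (hnext.resolve_left fun h =>
      h.elim (fun h => hr0 (h.eq_zero h5 h3)) hlow)
    have hpow : 2 ^ (p + 1) = 2 ^ p + 2 ^ p := by ring
    obtain ⟨v, rfl | rfl⟩ := Nat.even_or_odd' r
    · have e : m + 2 ^ p * (2 * v) = m + 2 ^ (p + 1) * v := by ring
      have hv : binOnes (2 * v) = binOnes v := binOnes_two_mul_add_s5 v 0 (by omega)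
      rw [e] at h5 h3 ⊢
      exact ih hzero (by omega) (hv ▸ hr) h5 h3
    · have e : m + 2 ^ p * (2 * v + 1) = m + 2 ^ p + 2 ^ (p + 1) * v := by ring
      rw [binOnes_two_mul_add_s5 v 1 (by omega)] at hr
      rw [e] at h5 h3 ⊢
      exact ih (hone.resolve_left (by omega)) (by omega) (by omega) h5 h3

theorem stmt5 (n : ℕ) (hn : binOnes n ≤ 5) (ht : binOnes (triangular n) = 3) :
    triangular n ∈ ({21, 28, 276, 1540} : Set ℕ) := by
  have hdouble : n * (n + 1) = 2 * triangular n :=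
    (Nat.mul_div_cancel' (Nat.even_mul_succ_self n).two_dvd).symm
  have h3 : binOnes (n * (n + 1)) = 3 := by
    rw [hdouble, ← ht]
    exact binOnes_two_mul_add_s5 _ 0 (by omega)
  have hs : search 25 5 0 0 = true := by decide +kernel
  have h := mem_of_search (r := n) hs (by norm_num) hn (by simpa using hn) (by simpa using h3)
  simp only [pow_zero, one_mul, zero_add, List.mem_cons, List.not_mem_nil, or_false] at h
  rcases h with rfl | rfl | rfl | rfl <;> simp [triangular]
end

section
/- For every natural number k ≥ 1, the triangular number t_{2^k} is not very triangular (its binary representation contains exactly two 1s, and 2 is not a triangular number). -/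
theorem binOnes_two_pow_mul_s11 (j m : ℕ) (hm : 0 < m) : binOnes (2 ^ j * m) = binOnes m := by
  simp [binOnes, Nat.digits_base_pow_mul one_lt_two hm]

theorem triangular_two_pow_succ (j : ℕ) :
    triangular (2 ^ (j + 1)) = 2 ^ j * (1 + 2 * 2 ^ j) := by
  unfold triangular
  apply Nat.div_eq_of_eq_mul_right two_pos
  ring

theorem binOnes_triangular_two_pow_succ (j : ℕ) : binOnes (triangular (2 ^ (j + 1))) = 2 := by
  have h : binOnes (2 ^ j) = 1 := by
    simpa [binOnes] using binOnes_two_pow_mul_s11 j 1 one_pos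
  rw [triangular_two_pow_succ, binOnes_two_pow_mul_s11 _ _ (by positivity), binOnes,
    Nat.digits_add 2 one_lt_two 1 (2 ^ j) one_lt_two (Or.inl one_ne_zero), List.sum_cons]
  change 1 + binOnes (2 ^ j) = 2
  rw [h]

theorem stmt11 (k : ℕ) (hk : 1 ≤ k) :
    ¬ IsVeryTriangular (triangular (2 ^ k)) ∧
      binOnes (triangular (2 ^ k)) = 2 ∧ ¬ IsTriangular 2 := by
  obtain ⟨j, rfl⟩ := Nat.exists_eq_add_of_le' hk
  have h := binOnes_triangular_two_pow_succ j
  exact ⟨fun hv => not_isTriangular_two (h ▸ hv.2), h, not_isTriangular_two⟩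
end

section
/- Let n > 5 be a natural number. Then for all natural numbers m ≥ n and all k with 0 ≤ k < 2^{⌊(n-1)/2⌋}, the binary representation of t_{2^m + 3 + k} contains the same number of 1s as the binary representation of t_{2^n + 3 + k}. -/
theorem binOnes_eq_mod_add_div (x : ℕ) : binOnes x = x % 2 + binOnes (x / 2) := by
  rcases Nat.eq_zero_or_pos x with rfl | hx
  · simp [binOnes]
  · simp [binOnes, Nat.digits_def' one_lt_two hx]

theorem binOnes_two_pow_mul_add_s12 (m x y : ℕ) (hy : y < 2 ^ m) :
    binOnes (2 ^ m * x + y) = binOnes x + binOnes y := by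
  induction m generalizing y with
  | zero =>
    obtain rfl : y = 0 := by simpa using hy
    simp [binOnes]
  | succ m ih =>
    have hdiv : (2 ^ (m + 1) * x + y) / 2 = 2 ^ m * x + y / 2 := by
      rw [pow_succ', mul_assoc]; omega
    have hmod : (2 ^ (m + 1) * x + y) % 2 = y % 2 := by
      rw [pow_succ', mul_assoc]; omega
    rw [binOnes_eq_mod_add_div (2 ^ (m + 1) * x + y), hdiv, hmod,
      ih _ (by rw [pow_succ] at hy; omega), binOnes_eq_mod_add_div y]
    omega

theorem two_mul_triangular (a : ℕ) : 2 * triangular a = a * (a + 1) :=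
  Nat.two_mul_div_two_of_even (Nat.even_mul_succ_self a)

theorem triangular_two_pow_succ_add (m a : ℕ) :
    triangular (2 ^ (m + 1) + a) = 2 ^ m * (2 ^ (m + 1) * 1 + (2 * a + 1)) + triangular a := by
  have h := two_mul_triangular (2 ^ (m + 1) + a)
  have ha := two_mul_triangular a
  rw [pow_succ] at *
  nlinarith

theorem binOnes_triangular_two_pow_succ_add (m a : ℕ) (ha : 2 * a + 1 < 2 ^ (m + 1))
    (ht : triangular a < 2 ^ m) :
    binOnes (triangular (2 ^ (m + 1) + a)) =
      binOnes 1 + binOnes (2 * a + 1) + binOnes (triangular a) := by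
  rw [triangular_two_pow_succ_add, binOnes_two_pow_mul_add_s12 _ _ _ ht,
    binOnes_two_pow_mul_add_s12 _ _ _ ha]

theorem triangular_three_add_lt_two_pow (p k : ℕ) (hp : 5 ≤ p) (hk : k < 2 ^ (p / 2)) :
    triangular (3 + k) < 2 ^ p := by
  have ht := two_mul_triangular (3 + k)
  obtain rfl | hp : p = 5 ∨ 6 ≤ p := by omega
  · norm_num at hk ⊢
    nlinarith
  · have h8 : 2 ^ 3 ≤ 2 ^ (p / 2) := Nat.pow_le_pow_right two_pos (by omega)
    have hsq : 2 ^ (p / 2) * 2 ^ (p / 2) ≤ 2 ^ p := by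
      rw [← pow_add]
      exact Nat.pow_le_pow_right two_pos (by omega)
    nlinarith

theorem two_mul_three_add_add_one_lt_two_pow (p k : ℕ) (hp : 5 ≤ p) (hk : k < 2 ^ (p / 2)) :
    2 * (3 + k) + 1 < 2 ^ (p + 1) := by
  have h : 2 ^ (p / 2 + 3) ≤ 2 ^ (p + 1) := Nat.pow_le_pow_right two_pos (by omega)
  have h4 : 2 ^ 2 ≤ 2 ^ (p / 2) := Nat.pow_le_pow_right two_pos (by omega)
  rw [pow_add] at h
  omega

theorem stmt12 (n : ℕ) (hn : n > 5) :
    ∀ m ≥ n, ∀ k < 2 ^ ((n - 1) / 2),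
      binOnes (triangular (2 ^ m + 3 + k)) = binOnes (triangular (2 ^ n + 3 + k)) := by
  intro m hm k hk
  obtain ⟨p, rfl⟩ : ∃ p, n = p + 1 := ⟨n - 1, by omega⟩
  obtain ⟨q, rfl⟩ : ∃ q, m = q + 1 := ⟨m - 1, by omega⟩
  rw [Nat.add_sub_cancel] at hk
  have ht := triangular_three_add_lt_two_pow p k (by omega) hk
  have ha := two_mul_three_add_add_one_lt_two_pow p k (by omega) hk
  rw [add_assoc, add_assoc, binOnes_triangular_two_pow_succ_add p _ ha ht,
    binOnes_triangular_two_pow_succ_add q _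
      (ha.trans_le (Nat.pow_le_pow_right two_pos hm))
      (ht.trans_le (Nat.pow_le_pow_right two_pos (by omega)))]
end

section
/- For every natural number n ≥ 4, the binary representation of the triangular number t_{2^n + 3} contains exactly six 1s; in particular, t_{2^n + 3} is very triangular. -/
/-- If the binary digits of `a` are followed by zeros and then by the digits of `m`, the
digit sums add. -/
theorem binOnes_add_two_pow_mul_s17 (a k : ℕ) {m : ℕ} (hm : 0 < m) :
    binOnes (a + 2 ^ ((Nat.digits 2 a).length + k) * m) = binOnes a + binOnes m := by
  simp [binOnes, ← Nat.digits_append_zeroes_append_digits (b := 2) one_lt_two hm]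

theorem triangular_two_pow_add_three (k : ℕ) :
    triangular (2 ^ (k + 4) + 3) = 6 + 2 ^ (3 + k) * (7 + 2 ^ (3 + (k + 1)) * 1) := by
  unfold triangular
  refine Nat.div_eq_of_eq_mul_left two_pos ?_
  ring

theorem binOnes_triangular_two_pow_add_three {n : ℕ} (hn : 4 ≤ n) :
    binOnes (triangular (2 ^ n + 3)) = 6 := by
  obtain ⟨k, rfl⟩ := Nat.exists_eq_add_of_le' hn
  have h6 := binOnes_add_two_pow_mul_s17 6 k (m := 7 + 2 ^ (3 + (k + 1)) * 1) (by positivity)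
  have h7 := binOnes_add_two_pow_mul_s17 7 (k + 1) (m := 1) one_pos
  rw [show (Nat.digits 2 6).length = 3 by simp] at h6
  rw [show (Nat.digits 2 7).length = 3 by simp] at h7
  rw [triangular_two_pow_add_three, h6, h7]
  simp [binOnes]

theorem stmt17 (n : ℕ) (hn : 4 ≤ n) :
    binOnes (triangular (2 ^ n + 3)) = 6 ∧ IsVeryTriangular (triangular (2 ^ n + 3)) := by
  have h := binOnes_triangular_two_pow_add_three hn
  exact ⟨h, ⟨_, rfl⟩, 3, h.symm⟩
end
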